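/- For every integer k with 1 ≤ k ≤ n+1 it holds that adapt(k) ≤ opt(2RO) + M·(n+1−k)/(k+1), where M := M_∞·p̄ − m_∞·p; i.e. k second-stage policies suffice to approximate the two-stage robust value with additive error M·(n+1−k)/(k+1). -/

import Mathlib

open scoped BigOperators

/-- Dot product of two vectors in `ℝ^ν`. -/
noncomputable def dot {ν : ℕ} (c x : Fin ν → ℝ) : ℝ := ∑ j, c j * x j

/-- `convComb S k` is the set of all convex combinations of at most `k` points of `S`. -/
def convComb {ν : ℕ} (S : Set (Fin ν → ℝ)) (k : ℕ) : Set (Fin ν → ℝ) :=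
  { x | ∃ (xs : Fin k → (Fin ν → ℝ)) (lam : Fin k → ℝ),
      (∀ i, xs i ∈ S) ∧ (∀ i, 0 ≤ lam i) ∧ (∑ i, lam i) = 1 ∧
      x = ∑ i, lam i • xs i }

/-- `‖y‖₀`, the number of nonzero entries of `y`, as a real number. -/
noncomputable def zeroNorm {ν : ℕ} (y : Fin ν → ℝ) : ℝ :=
  ((Finset.univ.filter (fun j => y j ≠ 0)).card : ℝ)

/-- The `k`-adaptability value
`adapt(k) = inf_{x ∈ X, y¹,…,y^k ∈ Y(x)} max_{ξ ∈ U} min_{i=1,…,k} (dᵀx + ξᵀyⁱ)`. -/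
noncomputable def adaptVal {μ ν : ℕ} (X : Set (Fin μ → ℝ)) (d : Fin μ → ℝ)
    (Y : (Fin μ → ℝ) → Set (Fin ν → ℝ)) (U : Set (Fin ν → ℝ)) (k : ℕ) : ℝ :=
  sInf { v : ℝ | ∃ x ∈ X, ∃ ys : Fin k → (Fin ν → ℝ), (∀ i, ys i ∈ Y x) ∧
    v = sSup ((fun ξ => dot d x + ⨅ i, dot ξ (ys i)) '' U) }

/-- The two-stage robust value
`opt(2RO) = inf_{x ∈ X} max_{ξ ∈ U} min_{y ∈ Y(x)} (dᵀx + ξᵀy)`. -/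
noncomputable def twoStageVal {μ ν : ℕ} (X : Set (Fin μ → ℝ)) (d : Fin μ → ℝ)
    (Y : (Fin μ → ℝ) → Set (Fin ν → ℝ)) (U : Set (Fin ν → ℝ)) : ℝ :=
  sInf { v : ℝ | ∃ x ∈ X, v = sSup ((fun ξ => dot d x + ⨅ y : (Y x), dot ξ (y : Fin ν → ℝ)) '' U) }

lemma dot_eq_dotProduct {ν : ℕ} (c x : Fin ν → ℝ) : dot c x = c ⬝ᵥ x := rfl

lemma continuous_dot {ν : ℕ} : Continuous fun q : (Fin ν → ℝ) × (Fin ν → ℝ) => dot q.1 q.2 := by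
  unfold dot
  fun_prop

/-- The `k` largest of finitely many weights have at least the average share of the total. -/
lemma Finset.exists_subset_card_mul_sum_le {ι : Type*} (s : Finset ι) (w : ι → ℝ) {k : ℕ}
    (hk : k ≤ s.card) :
    ∃ t ⊆ s, t.card = k ∧ (k : ℝ) * ∑ i ∈ s, w i ≤ s.card * ∑ i ∈ t, w i := by
  classical
  induction hk using Nat.decreasingInduction with
  | self => exact ⟨s, subset_rfl, rfl, le_rfl⟩
  | of_succ k hk ih =>
    obtain ⟨t, hts, htc, ht⟩ := ih
    obtain ⟨i, hi, hmin⟩ := t.exists_min_image w (Finset.card_pos.mp (by omega))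
    refine ⟨t.erase i, (t.erase_subset i).trans hts, by simp [hi, htc], ?_⟩
    have hsum := t.add_sum_erase w hi
    have hle : (k + 1 : ℝ) * w i ≤ ∑ j ∈ t, w j := by
      simpa [htc] using t.card_nsmul_le_sum w (w i) hmin
    push_cast at ht
    have hpos : (0 : ℝ) < k + 1 := by positivity
    refine le_of_mul_le_mul_left ?_ hpos
    have h₁ : (k : ℝ) * ((k + 1) * ∑ j ∈ s, w j) ≤ k * (s.card * ∑ j ∈ t, w j) := by gcongr
    have h₂ : (s.card : ℝ) * (k * ∑ j ∈ t, w j) ≤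
        s.card * ((k + 1) * ∑ j ∈ t.erase i, w j) := by
      refine mul_le_mul_of_nonneg_left ?_ (by positivity)
      rw [← hsum] at hle ⊢
      linarith
    linarith

/-- Keeping only part of the weights of a convex combination of reals in `[A, B]`, a common lower
bound of the kept values exceeds the combination by at most `B - A` times the lost weight. -/
lemma le_sum_add_of_le_on_subset {ι : Type*} [Fintype ι] (t : Finset ι) {w a : ι → ℝ}
    {A B μ : ℝ} (hw : ∀ i, 0 ≤ w i) (hw1 : ∑ i, w i = 1) (hA : ∀ i, A ≤ a i)
    (hμ : ∀ i ∈ t, μ ≤ a i) (hμB : μ ≤ B) :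
    μ ≤ ∑ i, w i * a i + (B - A) * (1 - ∑ i ∈ t, w i) := by
  classical
  have hsplit := Finset.sum_add_sum_compl t w
  have hsplit' := Finset.sum_add_sum_compl t fun i => w i * a i
  have h₁ : (∑ i ∈ t, w i) * μ ≤ ∑ i ∈ t, w i * a i := by
    rw [Finset.sum_mul]
    exact Finset.sum_le_sum fun i hi => mul_le_mul_of_nonneg_left (hμ i hi) (hw i)
  have h₂ : (∑ i ∈ tᶜ, w i) * A ≤ ∑ i ∈ tᶜ, w i * a i := by
    rw [Finset.sum_mul]
    exact Finset.sum_le_sum fun i _ => mul_le_mul_of_nonneg_left (hA i) (hw i)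
  have h₃ : 0 ≤ ∑ i ∈ tᶜ, w i := Finset.sum_nonneg fun i _ => hw i
  have hc : ∑ i ∈ tᶜ, w i = 1 - ∑ i ∈ t, w i := by linarith
  rw [hc] at h₂ h₃
  nlinarith [mul_le_mul_of_nonneg_left hμB h₃]

/-- Minimax for the bilinear form `dot` over a compact convex set and a finite set. -/
lemma exists_dot_le_of_convex_of_finite {n : ℕ} {U S : Set (Fin n → ℝ)} (hUne : U.Nonempty)
    (hUcomp : IsCompact U) (hUconv : Convex ℝ U) (hSne : S.Nonempty) (hSfin : S.Finite) :
    ∃ y₀ ∈ convexHull ℝ S, ∃ ξ₀ ∈ U, ∀ ξ ∈ U, ∀ y ∈ S, dot ξ y₀ ≤ dot ξ₀ y := by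
  obtain ⟨y₀, hy₀, ξ₀, hξ₀, h⟩ := Sion.exists_isSaddlePointOn
    (X := convexHull ℝ S) (Y := U) (f := fun y ξ => dot ξ y)
    hSne.convexHull (convex_convexHull ℝ S) (hSfin.isCompact_convexHull (𝕜 := ℝ))
    (fun ξ _ => (continuous_dot.comp
      (Continuous.prodMk_right ξ)).lowerSemicontinuous.lowerSemicontinuousOn _)
    (fun ξ _ => ((dotProductBilin ℝ ℝ ξ).convexOn (convex_convexHull ℝ S)).quasiconvexOn)
    hUconv hUne hUcomp
    (fun y _ => (continuous_dot.comp
      (Continuous.prodMk_left y)).upperSemicontinuous.upperSemicontinuousOn _)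
    (fun y _ => (((dotProductBilin ℝ ℝ).flip y).concaveOn hUconv).quasiconcaveOn)
  exact ⟨y₀, hy₀, ξ₀, hξ₀, fun ξ hξ y hy => h y (subset_convexHull ℝ S hy) ξ hξ⟩

/-- Among finitely many policies, `k` suffice to approximate the max-min value additively. -/
lemma exists_policies_iInf_dot_le {n k : ℕ} {U S : Set (Fin n → ℝ)} (hUne : U.Nonempty)
    (hUcomp : IsCompact U) (hUconv : Convex ℝ U) (hSne : S.Nonempty) (hSfin : S.Finite)
    {A B : ℝ} (hAB : ∀ ξ ∈ U, ∀ y ∈ S, dot ξ y ∈ Set.Icc A B) (hk : 1 ≤ k) (hkn : k ≤ n + 1) :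
    ∃ ys : Fin k → (Fin n → ℝ), (∀ i, ys i ∈ S) ∧ ∃ ξ₀ ∈ U, ∀ ξ ∈ U,
      ⨅ i, dot ξ (ys i) ≤ (⨅ y : S, dot ξ₀ (y : Fin n → ℝ)) +
        (B - A) * (((n : ℝ) + 1 - k) / ((k : ℝ) + 1)) := by
  obtain ⟨y₀, hy₀, ξ₀, hξ₀, hsaddle⟩ :=
    exists_dot_le_of_convex_of_finite hUne hUcomp hUconv hSne hSfin
  obtain ⟨ι, _, z, w, hz, hind, hw, hw1, rfl⟩ := eq_pos_convex_span_of_mem_convexHull hy₀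
  have hzS : ∀ i, z i ∈ S := fun i => hz ⟨i, rfl⟩
  have hcard : Fintype.card ι ≤ n + 1 :=
    hind.card_le_finrank_succ.trans
      (by simpa using Submodule.finrank_le (vectorSpan ℝ (Set.range z)))
  have hι : Nonempty ι := by
    by_contra h
    rw [not_nonempty_iff] at h
    simp at hw1
  have hcpos : 0 < Fintype.card ι := Fintype.card_pos
  obtain ⟨t, -, htc, ht⟩ := Finset.univ.exists_subset_card_mul_sum_le w
    (k := min k (Fintype.card ι)) (min_le_right _ _)
  rw [hw1, mul_one, Finset.card_univ] at ht
  have hlost : 1 - ∑ i ∈ t, w i ≤ ((n : ℝ) + 1 - k) / ((k : ℝ) + 1) := by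
    have hkn' : (k : ℝ) ≤ n + 1 := by exact_mod_cast hkn
    have hcn : (Fintype.card ι : ℝ) ≤ n + 1 := by exact_mod_cast hcard
    have hc : (0 : ℝ) < Fintype.card ι := by exact_mod_cast hcpos
    rcases le_or_gt (Fintype.card ι) k with hck | hck
    · rw [min_eq_right hck] at ht
      have : 1 ≤ ∑ i ∈ t, w i := le_of_mul_le_mul_left (by simpa using ht) hc
      have : 0 ≤ ((n : ℝ) + 1 - k) / ((k : ℝ) + 1) := div_nonneg (by linarith) (by positivity)
      linarith
    · rw [min_eq_left hck.le] at ht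
      have hs : 0 ≤ ∑ i ∈ t, w i := Finset.sum_nonneg fun i _ => (hw i).le
      have hs1 : ∑ i ∈ t, w i ≤ 1 :=
        hw1 ▸ Finset.sum_le_univ_sum_of_nonneg fun i => (hw i).le
      have hkc : (k : ℝ) + 1 ≤ Fintype.card ι := by exact_mod_cast hck
      rw [le_div_iff₀ (by positivity)]
      nlinarith [mul_le_mul_of_nonneg_right hcn hs,
        mul_le_mul_of_nonneg_right (hkc.trans hcn) (sub_nonneg.mpr hs1)]
  have htne : t.Nonempty := Finset.card_pos.mp (by omega)
  have : Nonempty t := htne.to_subtype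
  have : Nonempty (Fin k) := ⟨⟨0, hk⟩⟩
  obtain ⟨e⟩ : Nonempty (t ↪ Fin k) :=
    Function.Embedding.nonempty_of_card_le (by simp [htc])
  obtain ⟨r, hsurj⟩ : ∃ r : Fin k → t, Function.Surjective r :=
    ⟨Function.invFun e, Function.invFun_surjective e.injective⟩
  have : Nonempty S := hSne.to_subtype
  refine ⟨fun i => z (r i), fun i => hzS _, ξ₀, hξ₀, fun ξ hξ => ?_⟩
  have hmin : ∀ i ∈ t, ⨅ j, dot ξ (z (r j)) ≤ dot ξ (z i) := fun i hi => by
    obtain ⟨j, hj⟩ := hsurj ⟨i, hi⟩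
    exact (ciInf_le (Set.finite_range _).bddBelow j).trans_eq (by rw [hj])
  obtain ⟨i₀, hi₀⟩ := htne
  have hAB₀ := hAB ξ hξ _ (hzS i₀)
  have hbound := le_sum_add_of_le_on_subset t (fun i => (hw i).le) hw1
    (fun i => (hAB ξ hξ _ (hzS i)).1) hmin ((hmin i₀ hi₀).trans hAB₀.2)
  have hlin : dot ξ (∑ i, w i • z i) = ∑ i, w i * dot ξ (z i) := by
    simp [dot_eq_dotProduct, dotProduct_sum]
  refine hbound.trans (add_le_add ?_ ?_)
  · rw [← hlin]
    exact le_ciInf fun y => hsaddle ξ hξ y y.2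
  · exact mul_le_mul_of_nonneg_left hlost (sub_nonneg.mpr (hAB₀.1.trans hAB₀.2))

lemma zeroNorm_eq_sum_of_binary {ν : ℕ} {y : Fin ν → ℝ} (hy : ∀ j, y j = 0 ∨ y j = 1) :
    zeroNorm y = ∑ j, y j := by
  rw [zeroNorm, Finset.card_filter, Nat.cast_sum]
  refine Finset.sum_congr rfl fun j _ => ?_
  rcases hy j with h | h <;> simp [h]

lemma dot_mem_Icc_of_binary {ν : ℕ} {ξ y : Fin ν → ℝ} {a b : ℝ}
    (hy : ∀ j, y j = 0 ∨ y j = 1) (hξ : ∀ j, a ≤ ξ j ∧ ξ j ≤ b) :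
    dot ξ y ∈ Set.Icc (a * zeroNorm y) (b * zeroNorm y) := by
  have hy0 : ∀ j, 0 ≤ y j := fun j => by rcases hy j with h | h <;> simp [h]
  rw [zeroNorm_eq_sum_of_binary hy, Finset.mul_sum, Finset.mul_sum]
  exact ⟨Finset.sum_le_sum fun j _ => mul_le_mul_of_nonneg_right (hξ j).1 (hy0 j),
    Finset.sum_le_sum fun j _ => mul_le_mul_of_nonneg_right (hξ j).2 (hy0 j)⟩

/-- For every `1 ≤ k ≤ n+1`, `adapt(k) ≤ opt(2RO) + M·(n+1−k)/(k+1)`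
with `M = M_∞·p̄ − m_∞·p`. -/
theorem stmt17 (m n : ℕ) (hm : 0 < m) (hn : 0 < n)
    (X : Set (Fin m → ℝ)) (hXne : X.Nonempty) (hXcomp : IsCompact X)
    (d : Fin m → ℝ)
    (Y : (Fin m → ℝ) → Set (Fin n → ℝ))
    (hYfin : ∀ x ∈ X, (Y x).Finite) (hYne : ∀ x ∈ X, (Y x).Nonempty)
    (hYbin : ∀ x ∈ X, ∀ y ∈ Y x, ∀ j, y j = 0 ∨ y j = 1)
    (U : Set (Fin n → ℝ)) (hUne : U.Nonempty) (hUcomp : IsCompact U) (hUconv : Convex ℝ U)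
    (m_inf M_inf : ℝ) (hminf : 0 < m_inf) (hmM : m_inf ≤ M_inf)
    (hxi : ∀ ξ ∈ U, ∀ j, m_inf ≤ ξ j ∧ ξ j ≤ M_inf)
    (p pbar : ℝ) (hp0 : 0 ≤ p) (hppbar : p ≤ pbar)
    (hpy : ∀ x ∈ X, ∀ y ∈ Y x, p ≤ zeroNorm y ∧ zeroNorm y ≤ pbar)
    (k : ℕ) (hk : 1 ≤ k) (hkn : k ≤ n + 1) :
    adaptVal X d Y U k ≤ twoStageVal X d Y U +
      (M_inf * pbar - m_inf * p) * (((n : ℝ) + 1 - k) / ((k : ℝ) + 1)) := by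
  have hAB : ∀ x ∈ X, ∀ ξ ∈ U, ∀ y ∈ Y x, dot ξ y ∈ Set.Icc (m_inf * p) (M_inf * pbar) := by
    intro x hx ξ hξ y hy
    obtain ⟨h₁, h₂⟩ := dot_mem_Icc_of_binary (hYbin x hx y hy) (hxi ξ hξ)
    exact ⟨(mul_le_mul_of_nonneg_left (hpy x hx y hy).1 hminf.le).trans h₁,
      h₂.trans (mul_le_mul_of_nonneg_left (hpy x hx y hy).2 (hminf.le.trans hmM))⟩
  have : Nonempty (Fin k) := ⟨⟨0, hk⟩⟩
  obtain ⟨ξ₁, hξ₁⟩ := hUne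
  have hUne : U.Nonempty := ⟨ξ₁, hξ₁⟩
  obtain ⟨D, hD⟩ := (hXcomp.image (continuous_dot.comp (Continuous.prodMk_right d))).bddBelow
  have hbelow : BddBelow { v : ℝ | ∃ x ∈ X, ∃ ys : Fin k → (Fin n → ℝ), (∀ i, ys i ∈ Y x) ∧
      v = sSup ((fun ξ => dot d x + ⨅ i, dot ξ (ys i)) '' U) } := by
    refine ⟨D + m_inf * p, ?_⟩
    rintro v ⟨x, hx, ys, hys, rfl⟩
    have hbdd : BddAbove ((fun ξ => dot d x + ⨅ i, dot ξ (ys i)) '' U) := by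
      refine ⟨dot d x + M_inf * pbar, ?_⟩
      rintro _ ⟨ξ, hξ, rfl⟩
      let i : Fin k := ⟨0, hk⟩
      exact add_le_add_right ((ciInf_le (Set.finite_range _).bddBelow i).trans
        (hAB x hx ξ hξ _ (hys i)).2) _
    exact (add_le_add (hD ⟨x, hx, rfl⟩) (le_ciInf fun i => (hAB x hx ξ₁ hξ₁ _ (hys i)).1)).trans
      (le_csSup hbdd ⟨ξ₁, hξ₁, rfl⟩)
  rw [← sub_le_iff_le_add]
  obtain ⟨x₁, hx₁⟩ := hXne
  refine le_csInf ⟨_, x₁, hx₁, rfl⟩ ?_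
  rintro _ ⟨x, hx, rfl⟩
  rw [sub_le_iff_le_add]
  obtain ⟨ys, hys, ξ₀, hξ₀, hle⟩ := exists_policies_iInf_dot_le hUne hUcomp hUconv
    (hYne x hx) (hYfin x hx) (hAB x hx) hk hkn
  have hYfin' : Finite (Y x) := hYfin x hx
  have hbdd : BddAbove
      ((fun ξ => dot d x + ⨅ y : (Y x), dot ξ (y : Fin n → ℝ)) '' U) := by
    obtain ⟨y, hy⟩ := hYne x hx
    refine ⟨dot d x + M_inf * pbar, ?_⟩
    rintro _ ⟨ξ, hξ, rfl⟩
    exact add_le_add_right ((ciInf_le (Set.finite_range _).bddBelow (⟨y, hy⟩ : Y x)).trans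
      (hAB x hx ξ hξ y hy).2) _
  refine (csInf_le hbelow ⟨x, hx, ys, hys, rfl⟩).trans (csSup_le (hUne.image _) ?_)
  rintro _ ⟨ξ, hξ, rfl⟩
  have h₁ := hle ξ hξ
  have h₂ := le_csSup hbdd ⟨ξ₀, hξ₀, rfl⟩
  simp only at h₂ ⊢
  linarith
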